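/- Vitushkin-type lower bound in the uniform norm with explicit constant: let s ≥ 1 be an integer, l = m + α with m ∈ ℕ and 0 < α ≤ 1, and let n ≥ 1, d ≥ 2 be integers. Let P(x,ζ) = Σ_{|k| ≤ d} c_k(x) ζ^k be any family of functions on I^s parametrized polynomially by ζ = (ζ₁,…,ζ_n) ∈ ℝⁿ of degree at most d, with continuous coefficients c_k ∈ C(I^s). Then there exists h ∈ Λ_l(I^s) such that for every ζ ∈ ℝⁿ one has ‖h − P(·,ζ)‖_∞ ≥ C_∞(l,s) / (n·log d)^{l/s}, where C_∞(l,s) = 1 / ( √s · 2^{l+1} · 8^{l/s} · (m+1)^{m+1} · (4(1+e))^{s(m+1)} ). -/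

import Mathlib

open MeasureTheory Set

noncomputable section

/-- The unit cube `I^s = [0,1]^s` in `ℝ^s` (with the Euclidean norm). -/
def cube (s : ℕ) : Set (EuclideanSpace ℝ (Fin s)) :=
  {x | ∀ i, x i ∈ Icc (0:ℝ) 1}

/-- The Hölder class `Λ_l(I^s)` with `l = m + α`, `0 < α ≤ 1`: functions of class `C^m`
on the cube, all derivatives up to order `m` bounded by `1` in the uniform norm, and the
`m`-th derivative `α`-Hölder with constant `1`. -/
def HolderClass (s m : ℕ) (α : ℝ) (f : EuclideanSpace ℝ (Fin s) → ℝ) : Prop :=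
  ContDiffOn ℝ m f (cube s) ∧
  (∀ j ≤ m, ∀ x ∈ cube s, ‖iteratedFDerivWithin ℝ j f (cube s) x‖ ≤ 1) ∧
  ∀ x ∈ cube s, ∀ y ∈ cube s,
    ‖iteratedFDerivWithin ℝ m f (cube s) x - iteratedFDerivWithin ℝ m f (cube s) y‖
      ≤ ‖x - y‖ ^ α

/-- Multi-indices `k ∈ ℕ^n` with `|k| = Σ kᵢ ≤ d`. -/
def degSet (n d : ℕ) : Finset (Fin n → ℕ) :=
  (Fintype.piFinset fun _ => Finset.range (d + 1)).filter fun k => ∑ i, k i ≤ d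

/-- The explicit Vitushkin constant
`C_∞(l,s) = 1/(√s · 2^{l+1} · 8^{l/s} · (m+1)^{m+1} · (4(1+e))^{s(m+1)})`, `l = m + α`. -/
def Cinf (s m : ℕ) (α : ℝ) : ℝ :=
  1 / (Real.sqrt s * (2:ℝ) ^ ((m:ℝ) + α + 1) * (8:ℝ) ^ (((m:ℝ) + α) / s)
      * ((m:ℝ) + 1) ^ (m + 1) * (4 * (1 + Real.exp 1)) ^ (s * (m + 1)))

/-- Sign `±1` attached to membership of `i` in `T`. -/
def sg {ι : Type*} [DecidableEq ι] (T : Finset ι) (i : ι) : ℝ := if i ∈ T then 1 else -1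

lemma sg_mul_self {ι : Type*} [DecidableEq ι] (T : Finset ι) (i : ι) : sg T i * sg T i = 1 := by
  unfold sg; split_ifs <;> norm_num

lemma char_orth {ι : Type*} [Fintype ι] [DecidableEq ι] (T T' : Finset ι) :
    ∑ S : Finset ι, (∏ i ∈ S, sg T i) * (∏ i ∈ S, sg T' i)
      = if T = T' then (2:ℝ) ^ Fintype.card ι else 0 := by
  have h := Finset.prod_one_add (f := fun i => sg T i * sg T' i) (Finset.univ : Finset ι)
  simp only [Finset.prod_mul_distrib, Finset.powerset_univ] at h
  rw [← h]
  split_ifs with hT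
  · subst hT
    simp only [sg_mul_self]
    norm_num
  · obtain ⟨i, hi⟩ : ∃ i, ¬ (i ∈ T ↔ i ∈ T') := by
      by_contra hcon
      push Not at hcon
      exact hT (Finset.ext hcon)
    apply Finset.prod_eq_zero (Finset.mem_univ i)
    unfold sg
    by_cases h1 : i ∈ T <;> by_cases h2 : i ∈ T' <;> simp_all

/-- Parseval for the characters. -/
lemma char_parseval {ι : Type*} [Fintype ι] [DecidableEq ι] (b : Finset ι → ℝ) :
    ∑ S : Finset ι, (∑ T, b T * ∏ i ∈ S, sg T i) ^ 2
      = (2:ℝ) ^ Fintype.card ι * ∑ T, b T ^ 2 := by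
  have h1 : ∀ S : Finset ι, (∑ T, b T * ∏ i ∈ S, sg T i) ^ 2
      = ∑ T, ∑ T', b T * b T' * ((∏ i ∈ S, sg T i) * (∏ i ∈ S, sg T' i)) := by
    intro S
    rw [sq, Finset.sum_mul_sum]
    refine Finset.sum_congr rfl fun T _ => Finset.sum_congr rfl fun T' _ => by ring
  simp only [h1]
  rw [Finset.sum_comm]
  rw [Finset.mul_sum]
  refine Finset.sum_congr rfl fun T _ => ?_
  rw [Finset.sum_comm]
  simp only [← Finset.mul_sum, char_orth]
  simp
  ring

lemma rank_bound {ι : Type*} [Fintype ι] [DecidableEq ι]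
    (V : Submodule ℝ (EuclideanSpace ℝ (Finset ι))) (a b : ℝ) (ha : 0 < a) (hab : a ≤ b)
    (q : ι → Finset ι → ℝ) (hq : ∀ i T, a ≤ sg T i * q i T ∧ sg T i * q i T ≤ b)
    (hV : ∀ S : Finset ι, (WithLp.toLp 2 (fun T => ∏ i ∈ S, q i T) :
      EuclideanSpace ℝ (Finset ι)) ∈ V) :
    (1 + a / b) ^ Fintype.card ι ≤ Module.finrank ℝ V := by
  have hb : 0 < b := ha.trans_le hab
  set e := stdOrthonormalBasis ℝ V with he
  set D : ℝ := (2:ℝ) ^ Fintype.card ι with hD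
  have hDpos : 0 < D := by positivity
  -- total mass
  have hnorm : ∀ j, ∑ T, ((e j : EuclideanSpace ℝ (Finset ι)) T) ^ 2 = 1 := by
    intro j
    have h1 : ‖(e j : EuclideanSpace ℝ (Finset ι))‖ = 1 := by
      exact e.orthonormal.1 j
    have h2 := EuclideanSpace.norm_sq_eq (e j : EuclideanSpace ℝ (Finset ι))
    rw [h1] at h2
    simpa using h2.symm
  set I : Fin (Module.finrank ℝ V) → Finset ι → ℝ :=
    fun j S => ∑ T, (e j : EuclideanSpace ℝ (Finset ι)) T * ∏ i ∈ S, sg T i with hI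
  have htot : ∑ S, ∑ j, I j S ^ 2 = D * Module.finrank ℝ V := by
    rw [Finset.sum_comm]
    simp only [hI, char_parseval, hnorm]
    simp [hD, mul_comm]
  have hlow : ∀ S : Finset ι, D * (a / b) ^ S.card ≤ ∑ j, I j S ^ 2 := by
    intro S
    set f : V := ⟨_, hV S⟩ with hf
    set W : Finset ι → ℝ := fun T => ∏ i ∈ S, (sg T i * q i T) with hW
    have hWl : ∀ T, a ^ S.card ≤ W T := by
      intro T
      rw [← Finset.prod_const]
      exact Finset.prod_le_prod (fun _ _ => ha.le) (fun i _ => (hq i T).1)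
    have hWu : ∀ T, W T ≤ b ^ S.card := by
      intro T
      rw [← Finset.prod_const]
      exact Finset.prod_le_prod (fun i _ => ha.le.trans (hq i T).1) (fun i _ => (hq i T).2)
    have hsum : D * a ^ S.card ≤ ∑ T, W T := by
      calc D * a ^ S.card = ∑ T : Finset ι, a ^ S.card := by
            simp [hD]
        _ ≤ _ := Finset.sum_le_sum fun T _ => hWl T
    have hfT : ∀ T, (f : EuclideanSpace ℝ (Finset ι)) T = ∏ i ∈ S, q i T := fun T => rfl
    have hexp : ∀ T, (f : EuclideanSpace ℝ (Finset ι)) T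
        = ∑ j, e.repr f j * (e j : EuclideanSpace ℝ (Finset ι)) T := by
      intro T
      have h1 := congrArg (fun v : V => (v : EuclideanSpace ℝ (Finset ι)) T) (e.sum_repr f)
      simp only [Submodule.coe_sum, Submodule.coe_smul] at h1
      rw [← h1]
      simp
    have hW1 : ∑ T, W T = ∑ j, e.repr f j * I j S := by
      calc ∑ T, W T = ∑ T, (f : EuclideanSpace ℝ (Finset ι)) T * ∏ i ∈ S, sg T i := by
            refine Finset.sum_congr rfl fun T _ => ?_
            rw [hfT, hW]
            simp only [Finset.prod_mul_distrib]
            ring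
        _ = ∑ T, ∑ j, e.repr f j * ((e j : EuclideanSpace ℝ (Finset ι)) T * ∏ i ∈ S, sg T i) := by
            refine Finset.sum_congr rfl fun T _ => ?_
            rw [hexp, Finset.sum_mul]
            refine Finset.sum_congr rfl fun j _ => by ring
        _ = _ := by
            rw [Finset.sum_comm]
            simp only [hI, Finset.mul_sum]
    have hfn : ∑ j, e.repr f j ^ 2 = ∑ T, W T ^ 2 := by
      have h1 : ‖e.repr f‖ ^ 2 = ‖(f : EuclideanSpace ℝ (Finset ι))‖ ^ 2 := by
        rw [LinearIsometryEquiv.norm_map]; simp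
      rw [EuclideanSpace.norm_sq_eq, EuclideanSpace.norm_sq_eq] at h1
      simp only [Real.norm_eq_abs, sq_abs] at h1
      rw [h1]
      refine Finset.sum_congr rfl fun T _ => ?_
      rw [hfT, hW]
      simp only [← Finset.prod_pow]
      refine Finset.prod_congr rfl fun i _ => ?_
      rw [mul_pow, sq (sg T i), sg_mul_self, one_mul]
    have hW2 : ∑ T, W T ^ 2 ≤ b ^ S.card * ∑ T, W T := by
      rw [Finset.mul_sum]
      refine Finset.sum_le_sum fun T _ => ?_
      rw [sq]
      exact mul_le_mul_of_nonneg_right (hWu T) ((pow_pos ha _).le.trans (hWl T))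
    have hCS := Finset.sum_mul_sq_le_sq_mul_sq Finset.univ (fun j => e.repr f j) (fun j => I j S)
    rw [← hW1, hfn] at hCS
    have hpos : 0 < ∑ T, W T := lt_of_lt_of_le (by positivity) hsum
    have hIn : 0 ≤ ∑ j, I j S ^ 2 := Finset.sum_nonneg fun _ _ => sq_nonneg _
    have h3 : (∑ T, W T) * (∑ T, W T) ≤ (b ^ S.card * ∑ j, I j S ^ 2) * ∑ T, W T := by
      nlinarith [mul_le_mul_of_nonneg_right hW2 hIn]
    have h4 := le_of_mul_le_mul_right h3 hpos
    rw [div_pow, mul_div_assoc', div_le_iff₀ (by positivity)]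
    linarith
  have hfin : D * (1 + a / b) ^ Fintype.card ι ≤ D * Module.finrank ℝ V := by
    rw [← htot]
    have h5 := Finset.prod_one_add (f := fun _ : ι => a / b) (Finset.univ : Finset ι)
    simp only [Finset.prod_const, Finset.powerset_univ, Finset.card_univ] at h5
    rw [h5, Finset.mul_sum]
    exact Finset.sum_le_sum fun S _ => hlow S
  exact le_of_mul_le_mul_left hfin hDpos

lemma sign_bound {ι : Type*} [Fintype ι] [DecidableEq ι] (n d : ℕ) (a b : ℝ) (ha : 0 < a)
    (hab : a ≤ b) (c : ι → (Fin n → ℕ) → ℝ) (z : Finset ι → Fin n → ℝ)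
    (hq : ∀ i T, a ≤ sg T i * (∑ k ∈ degSet n d, c i k * ∏ j, z T j ^ k j) ∧
      sg T i * (∑ k ∈ degSet n d, c i k * ∏ j, z T j ^ k j) ≤ b) :
    (1 + a / b) ^ Fintype.card ι ≤ (degSet n (d * Fintype.card ι)).card := by
  classical
  set mono : (Fin n → ℕ) → EuclideanSpace ℝ (Finset ι) :=
    fun k => WithLp.toLp 2 (fun T => ∏ j, z T j ^ k j) with hmono
  set F := (degSet n (d * Fintype.card ι)).image mono with hF
  set V := Submodule.span ℝ (F : Set (EuclideanSpace ℝ (Finset ι))) with hVdef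
  have hr : Module.finrank ℝ V ≤ (degSet n (d * Fintype.card ι)).card :=
    (finrank_span_finset_le_card F).trans Finset.card_image_le
  refine le_trans ?_ (Nat.cast_le.mpr hr)
  refine rank_bound V a b ha hab _ hq ?_
  intro S
  set P : ι → MvPolynomial (Fin n) ℝ := fun i =>
    ∑ k ∈ degSet n d, MvPolynomial.monomial (Finsupp.equivFunOnFinite.symm k) (c i k) with hP
  have hPe : ∀ i T, MvPolynomial.eval (z T) (P i)
      = ∑ k ∈ degSet n d, c i k * ∏ j, z T j ^ k j := by
    intro i T
    simp only [hP, map_sum, MvPolynomial.eval_monomial]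
    refine Finset.sum_congr rfl fun k _ => ?_
    rw [Finsupp.prod_fintype _ _ (by simp)]
    simp
  have hPd : ∀ i, (P i).totalDegree ≤ d := by
    intro i
    refine (MvPolynomial.totalDegree_finsetSum _ _).trans (Finset.sup_le fun k hk => ?_)
    refine (MvPolynomial.totalDegree_monomial_le _ _).trans ?_
    rw [degSet, Finset.mem_filter] at hk
    rw [Finsupp.sum_fintype _ _ (by simp)]
    simpa using hk.2
  set Q := ∏ i ∈ S, P i with hQ
  have hQd : Q.totalDegree ≤ d * Fintype.card ι := by
    refine (MvPolynomial.totalDegree_finsetProd _ _).trans ?_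
    refine (Finset.sum_le_sum fun i _ => hPd i).trans ?_
    rw [Finset.sum_const, smul_eq_mul, mul_comm]
    exact Nat.mul_le_mul_left _ (Finset.card_le_univ S)
  have hQe : (WithLp.toLp 2 (fun T => ∏ i ∈ S, ∑ k ∈ degSet n d, c i k * ∏ j, z T j ^ k j) :
      EuclideanSpace ℝ (Finset ι)) = ∑ k ∈ Q.support, Q.coeff k • mono k := by
    ext T
    have : ∏ i ∈ S, ∑ k ∈ degSet n d, c i k * ∏ j, z T j ^ k j = MvPolynomial.eval (z T) Q := by
      simp only [hQ, map_prod, hPe]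
    simp only [this, MvPolynomial.eval_eq']
    simp [hmono]
  rw [hQe]
  refine Submodule.sum_mem _ fun k hk => Submodule.smul_mem _ _ (Submodule.subset_span ?_)
  have hkd := (MvPolynomial.le_totalDegree hk).trans hQd
  rw [Finsupp.sum_fintype _ _ (by simp)] at hkd
  simp only [hF, Finset.coe_image]
  refine ⟨k, ?_, rfl⟩
  rw [Finset.mem_coe, degSet, Finset.mem_filter]
  refine ⟨?_, hkd⟩
  rw [Fintype.mem_piFinset]
  intro i
  rw [Finset.mem_range, Nat.lt_succ_iff]
  exact (Finset.single_le_sum (f := fun i => k i) (fun _ _ => Nat.zero_le _)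
    (Finset.mem_univ i)).trans hkd

lemma card_degSet_le (n D : ℕ) (hn : 1 ≤ n) :
    ((degSet n D).card : ℝ) ≤ (Real.exp 1 * ((D + n) / n)) ^ n := by
  have hn' : (0:ℝ) < n := by exact_mod_cast hn
  -- weight exp(-θ)
  rcases Nat.eq_zero_or_pos D with hD | hD
  · subst hD
    have h1 : degSet n 0 ⊆ {fun _ => 0} := by
      intro k hk
      rw [degSet, Finset.mem_filter, Fintype.mem_piFinset] at hk
      simp only [Finset.mem_singleton]
      funext i
      have := hk.1 i
      simpa using this
    have h2 : ((degSet n 0).card : ℝ) ≤ 1 := by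
      exact_mod_cast (Finset.card_le_card h1).trans (by simp)
    refine h2.trans ?_
    have : (((0:ℕ):ℝ) + n) / n = 1 := by
      simp [hn'.ne']
    rw [this, mul_one]
    exact one_le_pow₀ (Real.one_le_exp (by norm_num))
  have hD' : (0:ℝ) < D := by exact_mod_cast hD
  set x : ℝ := D / (D + n) with hx
  have hx0 : 0 < x := by positivity
  have hx1 : x < 1 := by rw [hx, div_lt_one (by positivity)]; linarith
  have h1 : ((degSet n D).card : ℝ) * x ^ D ≤ (1 / (1 - x)) ^ n := by
    calc ((degSet n D).card : ℝ) * x ^ D = ∑ k ∈ degSet n D, x ^ D := by simp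
      _ ≤ ∑ k ∈ degSet n D, ∏ i, x ^ k i := by
          refine Finset.sum_le_sum fun k hk => ?_
          rw [Finset.prod_pow_eq_pow_sum]
          rw [degSet, Finset.mem_filter] at hk
          exact pow_le_pow_of_le_one hx0.le hx1.le hk.2
      _ ≤ ∑ k ∈ Fintype.piFinset (fun _ : Fin n => Finset.range (D + 1)), ∏ i, x ^ k i := by
          refine Finset.sum_le_sum_of_subset_of_nonneg (Finset.filter_subset _ _) ?_
          intro k _ _
          exact Finset.prod_nonneg fun i _ => by positivity
      _ = ∏ i : Fin n, ∑ j ∈ Finset.range (D + 1), x ^ j := by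
          rw [Finset.prod_univ_sum]
      _ ≤ ∏ i : Fin n, (1 / (1 - x)) := by
          refine Finset.prod_le_prod (fun _ _ => Finset.sum_nonneg fun _ _ => by positivity) ?_
          intro i _
          rw [geom_sum_eq hx1.ne, le_div_iff₀ (by linarith)]
          rw [div_mul_eq_mul_div, div_le_iff_of_neg (by linarith)]
          nlinarith [pow_pos hx0 (D+1)]
      _ = _ := by simp
  have h2 : 1 / (1 - x) = (D + n) / n := by
    have : 1 - x = n / (D + n) := by
      rw [hx]; field_simp; ring
    rw [this, one_div_div]
  have h3 : 1 / x = 1 + n / D := by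
    rw [hx]; field_simp
  have h4 : (1 / x) ^ D ≤ Real.exp 1 ^ n := by
    rw [h3]
    calc (1 + (n:ℝ) / D) ^ D ≤ (Real.exp (n / D)) ^ D := by
          gcongr
          linarith [Real.add_one_le_exp ((n:ℝ) / D)]
      _ = Real.exp 1 ^ n := by
          rw [← Real.exp_nat_mul, ← Real.exp_nat_mul]
          congr 1
          field_simp
  rw [h2] at h1
  calc ((degSet n D).card : ℝ) = ((degSet n D).card : ℝ) * x ^ D * (1 / x) ^ D := by
        rw [mul_assoc, ← mul_pow]
        simp [hx0.ne']
    _ ≤ ((D + n) / n) ^ n * Real.exp 1 ^ n := by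
        gcongr
    _ = _ := by rw [mul_pow, mul_comm]

lemma growth (t u : ℝ) (hu : Real.log 2 ≤ u) (ht : 16 * u ≤ t) :
    Real.exp 1 * (Real.exp u * t + 1) < Real.exp (0.43 * t) := by
  have hl := Real.log_two_gt_d9
  have ht11 : 11 ≤ t := by linarith
  have h1 : (1:ℝ) ≤ Real.exp u / 2 := by
    have : (2:ℝ) ≤ Real.exp u := by
      rw [← Real.log_le_iff_le_exp (by norm_num)]; exact hu
    linarith
  have h2 : Real.exp u * t + 1 ≤ Real.exp u * (t + 1/2) := by nlinarith
  -- t + 1/2 ≤ 12 * exp((t+1/2)/12 - 1)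
  have h3 : t + 1/2 ≤ 12 * Real.exp ((t + 1/2)/12 - 1) := by
    have := Real.add_one_le_exp ((t + 1/2)/12 - 1)
    linarith
  have h12 : (12:ℝ) ≤ Real.exp 2.6 := by
    have he := Real.exp_one_gt_d9
    have h5 : Real.exp 2.6 = Real.exp 1 ^ 2 * Real.exp 0.6 := by
      rw [← Real.exp_nat_mul, ← Real.exp_add]; norm_num
    have h6 := Real.quadratic_le_exp_of_nonneg (x := 0.6) (by norm_num)
    rw [h5]
    have h7 : (7.38:ℝ) ≤ Real.exp 1 ^ 2 := by nlinarith
    nlinarith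
  calc Real.exp 1 * (Real.exp u * t + 1)
      ≤ Real.exp 1 * (Real.exp u * (Real.exp 2.6 * Real.exp ((t + 1/2)/12 - 1))) := by
        gcongr
        refine h2.trans ?_
        gcongr
        refine h3.trans ?_
        gcongr
    _ = Real.exp (1 + (u + (2.6 + ((t + 1/2)/12 - 1)))) := by
        simp only [Real.exp_add]
    _ < _ := by
        rw [Real.exp_lt_exp]
        linarith

lemma base_exp : Real.exp 0.43 ≤ 1 + 7/13 := by
  have h := Real.exp_bound' (x := 0.43) (by norm_num) (by norm_num) (n := 5) (by norm_num)
  norm_num [Finset.sum_range_succ, Nat.factorial] at h ⊢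
  linarith

lemma count_contra (n d N : ℕ) (hn : 1 ≤ n) (hd : 2 ≤ d)
    (hN : 16 * ((n:ℝ) * Real.log d) ≤ N) :
    ((degSet n (d * N)).card : ℝ) < (1 + 7/13) ^ N := by
  have hn' : (0:ℝ) < n := by exact_mod_cast hn
  have hd' : (2:ℝ) ≤ d := by exact_mod_cast hd
  refine (card_degSet_le n (d * N) hn).trans_lt ?_
  set t : ℝ := N / n with ht
  have h1 : 16 * Real.log d ≤ t := by
    rw [ht, le_div_iff₀ hn']; linarith
  have h2 := growth t (Real.log d) (Real.log_le_log (by norm_num) hd') h1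
  rw [Real.exp_log (by linarith)] at h2
  have h3 : (((d * N : ℕ) : ℝ) + n) / n = d * t + 1 := by
    rw [ht]; push_cast; field_simp
  rw [h3]
  have ht0 : 0 ≤ t := by positivity
  calc (Real.exp 1 * (d * t + 1)) ^ n < (Real.exp (0.43 * t)) ^ n := by
        gcongr
    _ = Real.exp 0.43 ^ N := by
        rw [← Real.exp_nat_mul, ← Real.exp_nat_mul, ht]
        congr 1
        field_simp
    _ ≤ _ := by
        gcongr
        exact base_exp

/-- Pointwise derivative bounds `‖D^i f(x)‖ ≤ c a^i` for `i ≤ K`. -/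
def DB {E : Type*} [NormedAddCommGroup E] [NormedSpace ℝ E] (K : ℕ) (f : E → ℝ) (x : E)
    (c a : ℝ) : Prop := ∀ i ≤ K, ‖iteratedFDeriv ℝ i f x‖ ≤ c * a ^ i

lemma DB.mul {E : Type*} [NormedAddCommGroup E] [NormedSpace ℝ E] {K : ℕ} {f g : E → ℝ} {x : E}
    {c₁ a₁ c₂ a₂ : ℝ} (hf : ContDiff ℝ K f) (hg : ContDiff ℝ K g)
    (h₁ : DB K f x c₁ a₁) (h₂ : DB K g x c₂ a₂) :
    DB K (fun y => f y * g y) x (c₁ * c₂) (a₁ + a₂) := by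
  intro i hi
  refine (norm_iteratedFDeriv_mul_le hf hg x (by exact_mod_cast hi)).trans ?_
  rw [add_pow, Finset.mul_sum]
  refine Finset.sum_le_sum fun j hj => ?_
  have hj' : j ≤ i := by simpa [Nat.lt_succ_iff] using hj
  have e1 := h₁ j (hj'.trans hi)
  have e2 := h₂ (i - j) ((Nat.sub_le _ _).trans hi)
  calc (i.choose j : ℝ) * ‖iteratedFDeriv ℝ j f x‖ * ‖iteratedFDeriv ℝ (i - j) g x‖
      = (i.choose j : ℝ) * (‖iteratedFDeriv ℝ j f x‖ * ‖iteratedFDeriv ℝ (i - j) g x‖) := by ring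
    _ ≤ (i.choose j : ℝ) * ((c₁ * a₁ ^ j) * (c₂ * a₂ ^ (i - j))) := by
        gcongr
        exact (norm_nonneg _).trans e1
    _ = _ := by ring

lemma DB.one {E : Type*} [NormedAddCommGroup E] [NormedSpace ℝ E] (K : ℕ) (x : E) :
    DB K (fun _ : E => (1:ℝ)) x 1 0 := by
  intro i hi
  rcases Nat.eq_zero_or_pos i with h | h
  · subst h; simp
  · rw [iteratedFDeriv_const_of_ne (by omega)]
    simp [zero_pow (by omega : i ≠ 0)]

lemma DB.prod {E : Type*} [NormedAddCommGroup E] [NormedSpace ℝ E] {K : ℕ} {ι : Type*}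
    (S : Finset ι) {f : ι → E → ℝ} {x : E} {c : ι → ℝ} {a : ι → ℝ}
    (hf : ∀ i, ContDiff ℝ K (f i)) (h : ∀ i, DB K (f i) x (c i) (a i)) :
    DB K (fun y => ∏ i ∈ S, f i y) x (∏ i ∈ S, c i) (∑ i ∈ S, a i) := by
  classical
  induction S using Finset.induction_on with
  | empty => simpa using DB.one K x
  | insert i S hi ih =>
    simp only [Finset.prod_insert hi, Finset.sum_insert hi]
    exact DB.mul (hf i) (contDiff_prod fun j _ => hf j) (h i) ih

lemma DB.pow {E : Type*} [NormedAddCommGroup E] [NormedSpace ℝ E] {K : ℕ}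
    {f : E → ℝ} {x : E} {a : ℝ} (hf : ContDiff ℝ K f) (h : DB K f x 1 a) (k : ℕ) :
    DB K (fun y => f y ^ k) x 1 (k * a) := by
  have := DB.prod (Finset.range k) (f := fun _ => f) (c := fun _ => 1) (a := fun _ => a)
    (fun _ => hf) (fun _ => h)
  simpa using this

lemma hasDerivAt_pos_pow (n : ℕ) (t : ℝ) :
    HasDerivAt (fun t : ℝ => (max t 0) ^ (n + 2)) ((n + 2) * (max t 0) ^ (n + 1)) t := by
  rcases lt_trichotomy t 0 with ht | ht | ht
  · have h1 : (fun t : ℝ => (max t 0) ^ (n + 2)) =ᶠ[nhds t] fun _ => 0 := by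
      filter_upwards [Iio_mem_nhds ht] with y hy
      rw [max_eq_right (le_of_lt hy)]; simp
    rw [max_eq_right ht.le]
    simpa using (hasDerivAt_const t (0:ℝ)).congr_of_eventuallyEq h1
  · subst ht
    rw [hasDerivAt_iff_isLittleO_nhds_zero]
    simp only [max_self, zero_add]
    have : (fun h : ℝ => (max h 0) ^ (n + 2) - 0 ^ (n + 2) - h • (((n:ℝ) + 2) * 0 ^ (n + 1)))
        = fun h => (max h 0) ^ (n + 2) := by
      funext h; simp
    rw [this]
    have h2 : (fun h : ℝ => (max h 0) ^ (n + 2)) =O[nhds 0] fun h : ℝ => h ^ (n + 2) := by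
      apply Asymptotics.IsBigO.of_bound 1
      filter_upwards with h
      rw [norm_pow, norm_pow, one_mul]
      gcongr
      rw [Real.norm_eq_abs, Real.norm_eq_abs, abs_of_nonneg (le_max_right _ _)]
      exact max_le (le_abs_self _) (abs_nonneg _)
    exact h2.trans_isLittleO (Asymptotics.isLittleO_pow_id (by omega))
  · have h1 : (fun t : ℝ => (max t 0) ^ (n + 2)) =ᶠ[nhds t] fun t => t ^ (n + 2) := by
      filter_upwards [Ioi_mem_nhds ht] with y hy
      rw [max_eq_left (le_of_lt hy)]
    rw [max_eq_left ht.le]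
    have := (hasDerivAt_pow (n + 2) t).congr_of_eventuallyEq h1
    simpa using this

lemma contDiff_pos_pow (n : ℕ) : ContDiff ℝ n (fun t : ℝ => (max t 0) ^ (n + 1)) := by
  induction n with
  | zero =>
    simp only [Nat.cast_zero, contDiff_zero]
    fun_prop
  | succ n ih =>
    rw [Nat.cast_add, Nat.cast_one, contDiff_succ_iff_deriv]
    refine ⟨fun t => (hasDerivAt_pos_pow n t).differentiableAt, ?_, ?_⟩
    · intro h
      exact absurd h (by simp)
    · have : deriv (fun t : ℝ => (max t 0) ^ (n + 1 + 1))
          = fun t => ((n:ℝ) + 2) * (max t 0) ^ (n + 1) :=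
        funext fun t => (hasDerivAt_pos_pow n t).deriv
      rw [this]
      exact contDiff_const.mul ih

/-- One-dimensional bump, `C^K`, supported in `[0,1]`. -/
def bump1 (K : ℕ) (t : ℝ) : ℝ := 4 ^ (K + 1) * ((max t 0) ^ (K + 1) * (max (1 - t) 0) ^ (K + 1))

lemma bump1_contDiff (K : ℕ) : ContDiff ℝ K (bump1 K) := by
  unfold bump1
  refine contDiff_const.mul ((contDiff_pos_pow K).mul ?_)
  exact (contDiff_pos_pow K).comp (contDiff_const.sub contDiff_id)

lemma bump1_out (K : ℕ) {t : ℝ} (ht : t ∉ Ioo (0:ℝ) 1) : bump1 K t = 0 := by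
  unfold bump1
  by_cases h : 0 < t
  · have : 1 - t ≤ 0 := by
      by_contra h2
      exact ht ⟨h, by linarith⟩
    rw [max_eq_right this]; simp
  · rw [max_eq_right (not_lt.mp h)]; simp

lemma bump1_half (K : ℕ) : bump1 K (1/2) = 1 := by
  unfold bump1
  rw [max_eq_left (by norm_num), max_eq_left (by norm_num), ← mul_pow, ← mul_pow]
  norm_num

lemma parab_DB (K : ℕ) {t : ℝ} (ht : t ∈ Ioo (0:ℝ) 1) :
    DB K (fun y : ℝ => 4 * y * (1 - y)) t 1 4 := by
  intro i _
  rw [norm_iteratedFDeriv_eq_norm_iteratedDeriv]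
  have h1 : deriv (fun y : ℝ => 4 * y * (1 - y)) = fun y => 4 - 8 * y := by
    funext y
    have : HasDerivAt (fun y : ℝ => 4 * y * (1 - y)) (4 * 1 * (1 - y) + 4 * y * (0 - 1)) y :=
      ((hasDerivAt_id y).const_mul 4).mul ((hasDerivAt_const y (1:ℝ)).sub (hasDerivAt_id y))
    rw [this.deriv]; ring
  have h2 : deriv (fun y : ℝ => 4 - 8 * y) = fun _ => -8 := by
    funext y
    have : HasDerivAt (fun y : ℝ => 4 - 8 * y) (0 - 8 * 1) y :=
      (hasDerivAt_const y (4:ℝ)).sub ((hasDerivAt_id y).const_mul 8)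
    rw [this.deriv]; ring
  obtain ⟨h0, h0'⟩ := ht
  match i with
  | 0 =>
    simp only [iteratedDeriv_zero, Real.norm_eq_abs, pow_zero, mul_one]
    rw [abs_le]; constructor <;> nlinarith [sq_nonneg (2 * t - 1)]
  | 1 =>
    rw [iteratedDeriv_one, h1, Real.norm_eq_abs, abs_le]
    constructor <;> linarith
  | (j + 2) =>
    rw [iteratedDeriv_succ', iteratedDeriv_succ', h1, h2, iteratedDeriv_const]
    split_ifs with hj
    · subst hj; norm_num
    · simp

lemma bump1_DB (K : ℕ) (t : ℝ) :
    DB K (bump1 K) t ((Ioo (0:ℝ) 1).indicator (fun _ => 1) t) (4 * (K + 1)) := by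
  by_cases ht : t ∈ Ioo (0:ℝ) 1
  · rw [indicator_of_mem ht]
    have h1 : bump1 K =ᶠ[nhds t] fun y => (4 * y * (1 - y)) ^ (K + 1) := by
      filter_upwards [isOpen_Ioo.mem_nhds ht] with y hy
      unfold bump1
      rw [max_eq_left hy.1.le, max_eq_left (by linarith [hy.2]), ← mul_pow, ← mul_pow]
      ring
    have h2 := DB.pow (by fun_prop) (parab_DB K ht) (K + 1)
    intro i hi
    rw [(h1.iteratedFDeriv ℝ i).eq_of_nhds]
    refine (h2 i hi).trans (le_of_eq ?_)
    push_cast; ring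
  · rw [indicator_of_notMem ht]
    intro i hi
    have hcont : Continuous fun x => iteratedFDeriv ℝ i (bump1 K) x :=
      (bump1_contDiff K).continuous_iteratedFDeriv (by exact_mod_cast hi)
    have hcl : IsClosed {x | iteratedFDeriv ℝ i (bump1 K) x = 0} :=
      isClosed_eq hcont continuous_const
    have hz : ∀ U : Set ℝ, IsOpen U → Disjoint U (Ioo 0 1) → ∀ x ∈ closure U,
        iteratedFDeriv ℝ i (bump1 K) x = 0 := by
      intro U hU hdis x hx
      have hsub : U ⊆ {x | iteratedFDeriv ℝ i (bump1 K) x = 0} := by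
        intro y hy
        have h1 : bump1 K =ᶠ[nhds y] fun _ => 0 := by
          filter_upwards [hU.mem_nhds hy] with w hw
          exact bump1_out K (Set.disjoint_left.mp hdis hw)
        have h2 := (h1.iteratedFDeriv ℝ i).eq_of_nhds
        rw [mem_ofPred_eq, h2]
        exact congrFun iteratedFDeriv_fun_zero y
      exact closure_minimal hsub hcl hx
    have : iteratedFDeriv ℝ i (bump1 K) t = 0 := by
      by_cases h : t ≤ 0
      · apply hz (Iio 0) isOpen_Iio
        · rw [Set.disjoint_left]; intro y hy hy2; exact absurd hy2.1 (not_lt.mpr (le_of_lt hy))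
        · rw [closure_Iio]; exact h
      · apply hz (Ioi 1) isOpen_Ioi
        · rw [Set.disjoint_left]; intro y hy hy2; exact absurd hy2.2 (not_lt.mpr (le_of_lt hy))
        · rw [closure_Ioi]
          by_contra h2
          exact ht ⟨not_le.mp h, not_le.mp h2⟩
    rw [this]; simp

/-- coordinate bump -/
def cbump (s K p : ℕ) (i : Fin s) (r : ℝ) (x : EuclideanSpace ℝ (Fin s)) : ℝ :=
  bump1 K (p * x i - r)

lemma cbump_contDiff (s K p : ℕ) (i : Fin s) (r : ℝ) : ContDiff ℝ K (cbump s K p i r) := by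
  unfold cbump
  refine (bump1_contDiff K).comp ?_
  fun_prop

lemma cbump_DB (s K p : ℕ) (i : Fin s) (r : ℝ) (x : EuclideanSpace ℝ (Fin s)) :
    DB K (cbump s K p i r) x ((Ioo (0:ℝ) 1).indicator (fun _ => 1) (p * x i - r))
      (4 * (K + 1) * p) := by
  intro j hj
  set L : EuclideanSpace ℝ (Fin s) →L[ℝ] ℝ := (p:ℝ) • EuclideanSpace.proj i with hL
  have hLn : ‖L‖ ≤ p := by
    refine ContinuousLinearMap.opNorm_le_bound _ (by positivity) fun y => ?_
    have h1 : L y = p * y i := by simp [hL]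
    rw [h1, norm_mul, Real.norm_natCast]
    gcongr
    exact PiLp.norm_apply_le y i
  set f : ℝ → ℝ := fun t => bump1 K (t - r) with hf
  have hfc : ContDiff ℝ K f := (bump1_contDiff K).comp (contDiff_id.sub contDiff_const)
  have he : cbump s K p i r = f ∘ L := by
    funext y
    simp [cbump, hf, hL]
  have hLx : L x = p * x i := by simp [hL]
  rw [he, L.iteratedFDeriv_comp_right hfc x (by exact_mod_cast hj)]
  refine (ContinuousMultilinearMap.norm_compContinuousLinearMap_le _ _).trans ?_
  rw [hf, iteratedFDeriv_comp_sub, hLx]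
  rw [Finset.prod_const, Finset.card_univ, Fintype.card_fin, mul_pow, ← mul_assoc]
  have := bump1_DB K (p * x i - r) j hj
  gcongr
  exact (norm_nonneg _).trans this

/-- the full function with prescribed values `v` at the cell centres -/
def hfun (s K p : ℕ) (A : ℝ) (v : (Fin s → Fin p) → ℝ) (x : EuclideanSpace ℝ (Fin s)) : ℝ :=
  ∑ j : Fin s → Fin p, (A * v j) • ∏ i, cbump s K p i (j i : ℕ) x

lemma hfun_contDiff (s K p : ℕ) (A : ℝ) (v : (Fin s → Fin p) → ℝ) :
    ContDiff ℝ K (hfun s K p A v) := by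
  unfold hfun
  refine ContDiff.sum fun j _ => ContDiff.const_smul _ (contDiff_prod fun i _ => ?_)
  exact cbump_contDiff _ _ _ _ _

lemma hfun_DB (s K p : ℕ) (A : ℝ) (hA : 0 ≤ A) (v : (Fin s → Fin p) → ℝ) (hv : ∀ j, |v j| ≤ 1)
    (x : EuclideanSpace ℝ (Fin s)) :
    DB K (hfun s K p A v) x A (4 * (K + 1) * s * p) := by
  intro k hk
  set g : (Fin s → Fin p) → EuclideanSpace ℝ (Fin s) → ℝ :=
    fun j x => ∏ i, cbump s K p i (j i : ℕ) x with hg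
  have hgc : ∀ j, ContDiff ℝ K (g j) := fun j => contDiff_prod fun i _ => cbump_contDiff _ _ _ _ _
  have hgk : ∀ j, ContDiff ℝ k (g j) := fun j => (hgc j).of_le (by exact_mod_cast hk)
  set ind : (Fin s → Fin p) → ℝ := fun j =>
    ∏ i, (Ioo (0:ℝ) 1).indicator (fun _ => (1:ℝ)) (p * x i - (j i : ℕ)) with hind
  have hgb : ∀ j, ‖iteratedFDeriv ℝ k (g j) x‖ ≤ ind j * (4 * (K + 1) * s * p) ^ k := by
    intro j
    have := DB.prod Finset.univ (f := fun i => cbump s K p i (j i : ℕ)) (x := x)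
      (fun i => cbump_contDiff s K p i _) (fun i => cbump_DB s K p i _ x) k hk
    refine this.trans (le_of_eq ?_)
    simp only [Finset.sum_const, Finset.card_univ, Fintype.card_fin, nsmul_eq_mul, hind]
    ring
  have hind0 : ∀ j, 0 ≤ ind j := fun j =>
    Finset.prod_nonneg fun i _ => indicator_nonneg (fun _ _ => zero_le_one) _
  have hsum : ∑ j, ind j ≤ 1 := by
    have h1 := Finset.prod_univ_sum (fun _ : Fin s => (Finset.univ : Finset (Fin p)))
      (fun i (l : Fin p) => (Ioo (0:ℝ) 1).indicator (fun _ => (1:ℝ)) (p * x i - (l : ℕ)))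
    rw [Fintype.piFinset_univ] at h1
    rw [hind, ← h1]
    refine Finset.prod_le_one (fun i _ => Finset.sum_nonneg fun l _ =>
      indicator_nonneg (fun _ _ => zero_le_one) _) fun i _ => ?_
    by_cases hex : ∃ l : Fin p, (p * x i - (l : ℕ)) ∈ Ioo (0:ℝ) 1
    · obtain ⟨l, hl⟩ := hex
      rw [Finset.sum_eq_single l]
      · exact indicator_le_self' (fun _ _ => zero_le_one) _
      · intro l' _ hne
        apply indicator_of_notMem
        intro hl'
        apply hne
        have h3 : ((l:ℕ):ℝ) < (l':ℕ) + 1 := by linarith [hl.1, hl'.2]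
        have h4 : ((l':ℕ):ℝ) < (l:ℕ) + 1 := by linarith [hl'.1, hl.2]
        have h3' : (l:ℕ) < (l':ℕ) + 1 := by exact_mod_cast h3
        have h4' : (l':ℕ) < (l:ℕ) + 1 := by exact_mod_cast h4
        exact Fin.ext (by omega)
      · intro h; exact absurd (Finset.mem_univ _) h
    · rw [Finset.sum_eq_zero]
      · norm_num
      · intro l _
        exact indicator_of_notMem (fun h => hex ⟨l, h⟩) _
  have hexp : iteratedFDeriv ℝ k (hfun s K p A v) x
      = ∑ j, (A * v j) • iteratedFDeriv ℝ k (g j) x := by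
    have h1 : hfun s K p A v = fun y => ∑ j, (A * v j) • g j y := rfl
    rw [h1, iteratedFDeriv_sum (fun j _ => ContDiff.const_smul _ (hgk j)), Finset.sum_apply]
    refine Finset.sum_congr rfl fun j _ => ?_
    exact iteratedFDeriv_const_smul_apply' (hgk j).contDiffAt
  rw [hexp]
  calc ‖∑ j, (A * v j) • iteratedFDeriv ℝ k (g j) x‖
      ≤ ∑ j, ‖(A * v j) • iteratedFDeriv ℝ k (g j) x‖ := norm_sum_le _ _
    _ ≤ ∑ j, A * (ind j * (4 * (K + 1) * s * p) ^ k) := by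
        refine Finset.sum_le_sum fun j _ => ?_
        rw [norm_smul, norm_mul, Real.norm_eq_abs, Real.norm_eq_abs, abs_of_nonneg hA]
        have h1 : A * |v j| ≤ A := mul_le_of_le_one_right hA (hv j)
        exact mul_le_mul h1 (hgb j) (norm_nonneg _) hA
    _ = A * (4 * (K + 1) * s * p) ^ k * ∑ j, ind j := by
        rw [Finset.mul_sum]
        refine Finset.sum_congr rfl fun j _ => by ring
    _ ≤ A * (4 * (K + 1) * s * p) ^ k := mul_le_of_le_one_right (by positivity) hsum

/-- centres of the cells -/
def ctr (s p : ℕ) (j : Fin s → Fin p) : EuclideanSpace ℝ (Fin s) :=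
  WithLp.toLp 2 fun i => (((j i : ℕ) : ℝ) + 1/2) / p

lemma ctr_mem (s p : ℕ) (hp : 1 ≤ p) (j : Fin s → Fin p) : ctr s p j ∈ cube s := by
  intro i
  have hp' : (0:ℝ) < p := by exact_mod_cast hp
  have h1 : (((j i : ℕ) : ℝ) + 1) ≤ p := by exact_mod_cast (j i).2
  simp only [ctr]
  constructor
  · positivity
  · rw [div_le_one hp']; linarith

lemma hfun_ctr (s K p : ℕ) (hp : 1 ≤ p) (A : ℝ) (v : (Fin s → Fin p) → ℝ) (j : Fin s → Fin p) :
    hfun s K p A v (ctr s p j) = A * v j := by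
  have hp' : (0:ℝ) < p := by exact_mod_cast hp
  unfold hfun
  have harg : ∀ i, (p:ℝ) * ctr s p j i = (j i : ℕ) + 1/2 := by
    intro i
    simp only [ctr]
    field_simp
  rw [Finset.sum_eq_single j]
  · have : ∀ i, cbump s K p i (j i : ℕ) (ctr s p j) = 1 := by
      intro i
      rw [cbump, harg]
      rw [add_sub_cancel_left, bump1_half]
    simp [this]
  · intro j' _ hne
    obtain ⟨i, hi⟩ := Function.ne_iff.mp hne
    rw [Finset.prod_eq_zero (Finset.mem_univ i), smul_zero]
    rw [cbump, harg]
    apply bump1_out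
    rintro ⟨h1, h2⟩
    apply hi
    have h3 : ((j' i:ℕ):ℝ) < (j i:ℕ) + 1 := by linarith
    have h4 : ((j i:ℕ):ℝ) < (j' i:ℕ) + 1 := by linarith
    have h3' : (j' i:ℕ) < (j i:ℕ) + 1 := by exact_mod_cast h3
    have h4' : (j i:ℕ) < (j' i:ℕ) + 1 := by exact_mod_cast h4
    exact Fin.ext (by omega)
  · intro h; exact absurd (Finset.mem_univ _) h

lemma cube_convex (s : ℕ) : Convex ℝ (cube s) := by
  intro x hx y hy a b ha hb hab i
  have h := (convex_Icc (0:ℝ) 1) (hx i) (hy i) ha hb hab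
  simpa using h

lemma cube_uniqueDiff (s : ℕ) : UniqueDiffOn ℝ (cube s) := by
  refine uniqueDiffOn_convex (cube_convex s) ?_
  have hopen : IsOpen {x : EuclideanSpace ℝ (Fin s) | ∀ i, x i ∈ Ioo (0:ℝ) 1} := by
    simp only [ofPred_forall]
    exact isOpen_iInter_of_finite fun i => isOpen_Ioo.preimage (by fun_prop)
  refine ⟨WithLp.toLp 2 fun _ => 1/2, ?_⟩
  refine interior_maximal ?_ hopen ?_
  · intro x hx i
    exact Ioo_subset_Icc_self (hx i)
  · intro i
    simp only
    constructor <;> norm_num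

lemma hfun_holder (s m p : ℕ) (hs : 1 ≤ s) (hp : 1 ≤ p) (α : ℝ) (hα0 : 0 < α) (hα1 : α ≤ 1)
    (v : (Fin s → Fin p) → ℝ) (hv : ∀ j, |v j| ≤ 1) (A : ℝ)
    (hA : A = 1 / ((p:ℝ) ^ ((m:ℝ) + α) * (4 * ((m:ℝ) + 2) * s) ^ (m + 1))) :
    HolderClass s m α (hfun s (m + 1) p A v) := by
  have hp' : (1:ℝ) ≤ p := by exact_mod_cast hp
  have hs' : (1:ℝ) ≤ s := by exact_mod_cast hs
  have hp0 : (0:ℝ) < p := by linarith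
  set M : ℝ := 4 * ((m:ℝ) + 2) * s with hM
  have hM8 : 8 ≤ M := by
    have : (0:ℝ) ≤ m := Nat.cast_nonneg m
    rw [hM]; nlinarith
  have hA0 : 0 < A := by rw [hA]; positivity
  have hAeq : A * (p:ℝ) ^ m * (p:ℝ) ^ α * M ^ (m + 1) = 1 := by
    rw [hA, Real.rpow_add hp0, Real.rpow_natCast]
    field_simp
  set f := hfun s (m + 1) p A v with hf
  have hfc : ContDiff ℝ ((m + 1 : ℕ)) f := hfun_contDiff _ _ _ _ _
  have hfcm : ContDiff ℝ m f := hfc.of_le (by exact_mod_cast Nat.le_succ m)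
  have hDB : ∀ x, ∀ i ≤ m + 1, ‖iteratedFDeriv ℝ i f x‖ ≤ A * (M * p) ^ i := by
    intro x i hi
    have := hfun_DB s (m + 1) p A hA0.le v hv x i hi
    refine this.trans (le_of_eq ?_)
    rw [hM]; push_cast; ring
  have hw : ∀ i ≤ m, ∀ x ∈ cube s,
      iteratedFDerivWithin ℝ i f (cube s) x = iteratedFDeriv ℝ i f x := by
    intro i hi x hx
    exact iteratedFDerivWithin_eq_iteratedFDeriv (cube_uniqueDiff s)
      (hfcm.of_le (by exact_mod_cast hi)).contDiffAt hx
  have hpα : (1:ℝ) ≤ (p:ℝ) ^ α := Real.one_le_rpow hp' hα0.le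
  refine ⟨hfcm.contDiffOn, ?_, ?_⟩
  · intro i hi x hx
    rw [hw i hi x hx]
    refine (hDB x i (by omega)).trans ?_
    rw [← hAeq]
    have h1 : (M * p) ^ i ≤ (M * p) ^ m := pow_le_pow_right₀ (by nlinarith) hi
    have h2 : M ^ m ≤ M ^ (m + 1) := pow_le_pow_right₀ (by linarith) (Nat.le_succ m)
    calc A * (M * p) ^ i ≤ A * (M * p) ^ m := by gcongr
      _ = A * (p:ℝ) ^ m * 1 * M ^ m := by rw [mul_pow]; ring
      _ ≤ _ := by gcongr
  · intro x hx y hy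
    rw [hw m le_rfl x hx, hw m le_rfl y hy]
    set r := ‖x - y‖ with hr
    have hr0 : 0 ≤ r := norm_nonneg _
    have b1 : ‖iteratedFDeriv ℝ m f x - iteratedFDeriv ℝ m f y‖ ≤ A * (M * p) ^ m * 2 := by
      have e1 := hDB x m (by omega)
      have e2 := hDB y m (by omega)
      linarith [norm_sub_le (iteratedFDeriv ℝ m f x) (iteratedFDeriv ℝ m f y)]
    have b2 : ‖iteratedFDeriv ℝ m f x - iteratedFDeriv ℝ m f y‖ ≤ A * (M * p) ^ (m + 1) * r := by
      refine Convex.norm_image_sub_le_of_norm_fderiv_le (𝕜 := ℝ) (s := univ) ?_ ?_ convex_univ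
        (mem_univ y) (mem_univ x)
      · intro z _
        exact (hfc.differentiable_iteratedFDeriv (by exact_mod_cast Nat.lt_succ_self m)) z
      · intro z _
        rw [norm_fderiv_iteratedFDeriv]
        exact hDB z (m + 1) le_rfl
    have hfin : ∀ u : ℝ, u = p * r → A * (p:ℝ) ^ m * M ^ (m + 1) * u ^ α = r ^ α := by
      intro u hu
      rw [hu, Real.mul_rpow hp0.le hr0]
      linear_combination (r ^ α) * hAeq
    rw [← hfin _ rfl]
    by_cases hu : p * r ≤ 1
    · refine b2.trans ?_
      have h1 : p * r ≤ (p * r) ^ α :=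
        Real.self_le_rpow_of_le_one (by positivity) hu hα1
      calc A * (M * p) ^ (m + 1) * r = A * (p:ℝ) ^ m * M ^ (m + 1) * (p * r) := by
            rw [mul_pow]; ring
        _ ≤ _ := by gcongr
    · refine b1.trans ?_
      have h1 : 1 ≤ (p * r) ^ α := Real.one_le_rpow (not_le.mp hu).le hα0.le
      calc A * (M * p) ^ m * 2 = A * (p:ℝ) ^ m * (M ^ m * 2) := by
            rw [mul_pow]; ring
        _ ≤ A * (p:ℝ) ^ m * (M ^ m * M) := by gcongr; linarith
        _ = A * (p:ℝ) ^ m * M ^ (m + 1) * 1 := by ring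
        _ ≤ _ := by gcongr

lemma num_core (s m p : ℕ) (hs : 1 ≤ s) (hp : 1 ≤ p) (α : ℝ) (hα0 : 0 < α)
    (L q κ w : ℝ) (hL : 0 < L) (hq : q = (16 * L) ^ (1 / (s:ℝ))) (hκ : 0 < κ) (hw0 : 0 < w)
    (hpq : p ≤ κ * q)
    (hw : (2:ℝ) ^ (((m:ℝ) + α) / s) * (κ / 2) ^ ((m:ℝ) + α) ≤ w ^ (m + 1))
    (hE : 8 * s * w ≤ 0.6 * (4 * (1 + Real.exp 1)) ^ s) :
    Cinf s m α / L ^ (((m:ℝ) + α) / s) ≤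
      3/10 * (1 / ((p:ℝ) ^ ((m:ℝ) + α) * (4 * ((m:ℝ) + 2) * s) ^ (m + 1))) := by
  have hs' : (1:ℝ) ≤ s := by exact_mod_cast hs
  have hs0 : (0:ℝ) < s := by linarith
  have hp0 : (0:ℝ) < p := by exact_mod_cast hp
  have hm0 : (0:ℝ) ≤ m := Nat.cast_nonneg m
  set l : ℝ := (m:ℝ) + α with hl
  have hl0 : 0 < l := by linarith
  have hq0 : 0 < q := by rw [hq]; positivity
  set E : ℝ := 4 * (1 + Real.exp 1) with hEdef
  have hE0 : 0 < E := by positivity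
  set X : ℝ := ((m:ℝ) + 1) ^ (m + 1) with hX
  have hX0 : 0 < X := by positivity
  -- L power
  have hLq : L ^ (l / s) = q ^ l / (16:ℝ) ^ (l / s) := by
    rw [hq, ← Real.rpow_mul (by positivity), eq_div_iff (by positivity),
      ← Real.mul_rpow hL.le (by norm_num)]
    congr 1 <;> ring
  have h16 : (16:ℝ) ^ (l / s) = (2:ℝ) ^ (l / s) * (8:ℝ) ^ (l / s) := by
    rw [← Real.mul_rpow (by norm_num) (by norm_num)]; norm_num
  have h2l : (2:ℝ) ^ (l + 1) = 2 ^ l * 2 := by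
    rw [Real.rpow_add (by norm_num), Real.rpow_one]
  have hpl : (p:ℝ) ^ l ≤ κ ^ l * q ^ l := by
    rw [← Real.mul_rpow hκ.le hq0.le]
    exact Real.rpow_le_rpow hp0.le hpq hl0.le
  have hκ2 : (κ / 2) ^ l = κ ^ l / 2 ^ l := Real.div_rpow hκ.le (by norm_num) _
  have hM : (4 * ((m:ℝ) + 2) * s) ^ (m + 1) ≤ (8 * s) ^ (m + 1) * X := by
    rw [hX, ← mul_pow]
    apply pow_le_pow_left₀ (by positivity)
    nlinarith
  have hfinal : w ^ (m + 1) * (8 * s) ^ (m + 1) ≤ 0.6 * E ^ (s * (m + 1)) := by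
    rw [← mul_pow, pow_mul]
    calc (w * (8 * s)) ^ (m + 1) ≤ (0.6 * E ^ s) ^ (m + 1) := by
          apply pow_le_pow_left₀ (by positivity)
          linarith
      _ = 0.6 ^ (m + 1) * (E ^ s) ^ (m + 1) := mul_pow _ _ _
      _ ≤ 0.6 * (E ^ s) ^ (m + 1) := by
          gcongr
          exact pow_le_of_le_one (by norm_num) (by norm_num) (by omega)
  have hsq : 1 ≤ Real.sqrt s := Real.one_le_sqrt.mpr hs'
  have hCinf : Cinf s m α = 1 / (Real.sqrt s * (2 ^ l * 2) * (8:ℝ) ^ (l / s) * X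
      * E ^ (s * (m + 1))) := by
    rw [Cinf, ← h2l]
  rw [hCinf, hLq, h16]
  have h8 : (0:ℝ) < (8:ℝ) ^ (l / s) := by positivity
  have e1 : 1 / (Real.sqrt s * (2 ^ l * 2) * (8:ℝ) ^ (l / s) * X * E ^ (s * (m + 1))) /
      (q ^ l / ((2:ℝ) ^ (l / s) * (8:ℝ) ^ (l / s)))
      = (2:ℝ) ^ (l / s) / (Real.sqrt s * (2 ^ l * 2) * X * E ^ (s * (m + 1)) * q ^ l) := by
    field_simp
  rw [e1, mul_one_div, div_le_div_iff₀ (by positivity) (by positivity)]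
  have key : (2:ℝ) ^ (l / s) * κ ^ l * (8 * s) ^ (m + 1) ≤ 0.6 * 2 ^ l * E ^ (s * (m + 1)) := by
    rw [hκ2, mul_div_assoc', div_le_iff₀ (by positivity)] at hw
    calc (2:ℝ) ^ (l / s) * κ ^ l * (8 * s) ^ (m + 1)
        ≤ w ^ (m + 1) * 2 ^ l * (8 * s) ^ (m + 1) := by gcongr
      _ = 2 ^ l * (w ^ (m + 1) * (8 * s) ^ (m + 1)) := by ring
      _ ≤ 2 ^ l * (0.6 * E ^ (s * (m + 1))) := by gcongr
      _ = _ := by ring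
  calc (2:ℝ) ^ (l / s) * ((p:ℝ) ^ l * (4 * ((m:ℝ) + 2) * s) ^ (m + 1))
      ≤ (2:ℝ) ^ (l / s) * ((κ ^ l * q ^ l) * ((8 * s) ^ (m + 1) * X)) := by gcongr
    _ = ((2:ℝ) ^ (l / s) * κ ^ l * (8 * s) ^ (m + 1)) * (q ^ l * X) := by ring
    _ ≤ (0.6 * 2 ^ l * E ^ (s * (m + 1))) * (q ^ l * X) := by gcongr
    _ = 1 * (0.6 * 2 ^ l * E ^ (s * (m + 1)) * (q ^ l * X)) := by ring
    _ ≤ Real.sqrt s * (0.6 * 2 ^ l * E ^ (s * (m + 1)) * (q ^ l * X)) := by gcongr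
    _ = _ := by ring

lemma num_exists (s m : ℕ) (hs : 1 ≤ s) (α : ℝ) (hα0 : 0 < α) (hα1 : α ≤ 1)
    (L : ℝ) (hL : Real.log 2 ≤ L) :
    ∃ p : ℕ, 1 ≤ p ∧ 16 * L ≤ (p:ℝ) ^ s ∧
      Cinf s m α / L ^ (((m:ℝ) + α) / s) ≤
      3/10 * (1 / ((p:ℝ) ^ ((m:ℝ) + α) * (4 * ((m:ℝ) + 2) * s) ^ (m + 1))) := by
  have hlog := Real.log_two_gt_d9
  have hL0 : 0 < L := by linarith
  have hs' : (1:ℝ) ≤ s := by exact_mod_cast hs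
  have hs0 : (0:ℝ) < s := by linarith
  have hm0 : (0:ℝ) ≤ m := Nat.cast_nonneg m
  set q : ℝ := (16 * L) ^ (1 / (s:ℝ)) with hq
  have hq1 : 1 ≤ q := Real.one_le_rpow (by linarith) (by positivity)
  have hqs : q ^ s = 16 * L := by
    rw [hq, ← Real.rpow_natCast, ← Real.rpow_mul (by linarith)]
    rw [one_div, inv_mul_cancel₀ hs0.ne', Real.rpow_one]
  have hpq : q ≤ ⌈q⌉₊ := Nat.le_ceil q
  have hpq1 : (⌈q⌉₊ : ℝ) < q + 1 := Nat.ceil_lt_add_one (by linarith)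
  have hp1 : 1 ≤ ⌈q⌉₊ := Nat.one_le_ceil_iff.mpr (by linarith)
  have he := Real.exp_one_gt_d9
  refine ⟨⌈q⌉₊, hp1, ?_, ?_⟩
  · rw [← hqs]
    gcongr
  · have hlm : (m:ℝ) + α ≤ ((m + 1 : ℕ) : ℝ) := by push_cast; linarith
    rcases Nat.lt_or_ge s 2 with h | h
    · have hs1 : s = 1 := by omega
      have hq11 : 11 ≤ q := by
        rw [hs1, pow_one] at hqs
        rw [hqs]; linarith
      have hp11 : (⌈q⌉₊ : ℝ) ≤ 1.1 * q := by
        norm_num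
        linarith
      clear_value q
      subst hs1
      refine num_core 1 m _ hs hp1 α hα0 L q 1.1 1.1 hL0 hq (by norm_num) (by norm_num)
        hp11 ?_ ?_
      · rw [Nat.cast_one, div_one, ← Real.mul_rpow (by norm_num) (by norm_num)]
        norm_num only
        rw [← Real.rpow_natCast]
        exact Real.rpow_le_rpow_of_exponent_le (by norm_num) hlm
      · norm_num
        linarith
    · refine num_core s m _ hs hp1 α hα0 L q 2 2 hL0 hq (by norm_num) (by norm_num)
        (by linarith) ?_ ?_
      · rw [div_self (by norm_num), Real.one_rpow, mul_one, ← Real.rpow_natCast]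
        refine Real.rpow_le_rpow_of_exponent_le (by norm_num) (le_trans ?_ hlm)
        exact div_le_self (by linarith) hs'
      · have h14 : (14:ℝ) ≤ 4 * (1 + Real.exp 1) := by linarith
        have hpow : (14:ℝ) ^ s ≤ (4 * (1 + Real.exp 1)) ^ s :=
          pow_le_pow_left₀ (by norm_num) h14 s
        have hind : ∀ k : ℕ, 2 ≤ k → 8 * (k:ℝ) * 2 ≤ 0.6 * (14:ℝ) ^ k := by
          intro k hk
          induction k, hk using Nat.le_induction with
          | base => norm_num
          | succ k hk ih =>
            have : (2:ℝ) ≤ k := by exact_mod_cast hk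
            rw [pow_succ]; push_cast
            linarith
        linarith [hind s h]

/-- **Vitushkin-type lower bound in the uniform norm with explicit constant.**
For any family `P(x,ζ) = Σ_{|k| ≤ d} c_k(x) ζ^k` with continuous coefficients on `I^s`,
there is `h ∈ Λ_l(I^s)` such that for every `ζ ∈ ℝⁿ`,
`‖h − P(·,ζ)‖_∞ ≥ C_∞(l,s)/(n log d)^{l/s}`. -/
theorem stmt_0 (s m : ℕ) (hs : 1 ≤ s) (α : ℝ) (hα0 : 0 < α) (hα1 : α ≤ 1)
    (n d : ℕ) (hn : 1 ≤ n) (hd : 2 ≤ d)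
    (c : (Fin n → ℕ) → EuclideanSpace ℝ (Fin s) → ℝ)
    (hc : ∀ k ∈ degSet n d, ContinuousOn (c k) (cube s)) :
    ∃ h : EuclideanSpace ℝ (Fin s) → ℝ, HolderClass s m α h ∧
      ∀ ζ : Fin n → ℝ, ∃ x ∈ cube s,
        Cinf s m α / ((n : ℝ) * Real.log d) ^ (((m:ℝ) + α) / s) ≤
          |h x - ∑ k ∈ degSet n d, c k x * ∏ i, ζ i ^ k i| := by
  have hL : Real.log 2 ≤ (n:ℝ) * Real.log d := by
    have h1 : (1:ℝ) ≤ n := by exact_mod_cast hn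
    have h2 : Real.log 2 ≤ Real.log d :=
      Real.log_le_log (by norm_num) (by exact_mod_cast hd)
    have h3 : 0 ≤ Real.log 2 := Real.log_nonneg (by norm_num)
    nlinarith
  obtain ⟨p, hp, hpL, hnum⟩ := num_exists s m hs α hα0 hα1 _ hL
  by_contra hcon
  push Not at hcon
  set ε := Cinf s m α / ((n : ℝ) * Real.log d) ^ (((m:ℝ) + α) / s) with hε
  set A : ℝ := 1 / ((p:ℝ) ^ ((m:ℝ) + α) * (4 * ((m:ℝ) + 2) * s) ^ (m + 1)) with hA
  have hp' : (0:ℝ) < p := by exact_mod_cast hp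
  have hs' : (0:ℝ) < s := by exact_mod_cast hs
  have hA0 : 0 < A := by rw [hA]; positivity
  have hv : ∀ (T : Finset (Fin s → Fin p)) j, |sg T j| ≤ 1 := by
    intro T j
    unfold sg; split_ifs <;> norm_num
  have hex : ∀ T : Finset (Fin s → Fin p), ∃ ζ : Fin n → ℝ, ∀ x ∈ cube s,
      |hfun s (m + 1) p A (sg T) x - ∑ k ∈ degSet n d, c k x * ∏ i, ζ i ^ k i| < ε :=
    fun T => hcon _ (hfun_holder s m p hs hp α hα0 hα1 (sg T) (hv T) A hA)
  choose z hz using hex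
  have hb := sign_bound (ι := Fin s → Fin p) n d (7/10 * A) (13/10 * A) (by positivity)
    (by linarith) (fun j k => c k (ctr s p j)) z (by
      intro j T
      have h1 := hz T (ctr s p j) (ctr_mem s p hp j)
      rw [hfun_ctr s (m + 1) p hp, abs_lt] at h1
      have h2 : sg T j = 1 ∨ sg T j = -1 := by
        unfold sg; split_ifs <;> simp
      rcases h2 with h2 | h2 <;> rw [h2] at h1 ⊢ <;> constructor <;> linarith [h1.1, h1.2])
  have hab : 7/10 * A / (13/10 * A) = 7/13 := by
    field_simp
  rw [hab] at hb
  have hcard : Fintype.card (Fin s → Fin p) = p ^ s := by simp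
  rw [hcard] at hb
  have hc2 := count_contra n d (p ^ s) hn hd (by push_cast; exact hpL)
  linarith

end
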